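/- arXiv:1906.04483 — 4 statements merged into one kernel-verified Lean document; each statement's English description precedes it below -/
import Mathlib

section
/- For all real θ, ζ, k, the matrix P = S(k) ⬝ C(θ,−ζ) ⬝ S(k) ⬝ C(θ,ζ) has determinant 1 and trace 2(cos²θ · cos 2k + sin²θ · cos 2ζ); consequently its characteristic polynomial is X² − 2(cos²θ cos 2k + sin²θ cos 2ζ)·X + 1. -/
open Matrix Complex Polynomial

/-- The coin operator of the Plastic quantum walk. -/
noncomputable def coinC (θ ζ : ℝ) : Matrix (Fin 2) (Fin 2) ℂ :=
  !![-(Real.cos θ : ℂ), Complex.exp (-Complex.I * ζ) * Real.sin θ;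
     Complex.exp (Complex.I * ζ) * Real.sin θ, (Real.cos θ : ℂ)]

/-- S(k) = [[e^{ik},0],[0,e^{−ik}]]. -/
noncomputable def Smat (k : ℝ) : Matrix (Fin 2) (Fin 2) ℂ :=
  !![Complex.exp (Complex.I * k), 0; 0, Complex.exp (-Complex.I * k)]

theorem two_step_walk_det_trace_charpoly (θ ζ k : ℝ) :
    (Smat k * coinC θ (-ζ) * Smat k * coinC θ ζ).det = 1 ∧
    (Smat k * coinC θ (-ζ) * Smat k * coinC θ ζ).trace =
      ((2 * (Real.cos θ ^ 2 * Real.cos (2 * k) + Real.sin θ ^ 2 * Real.cos (2 * ζ)) : ℝ) : ℂ) ∧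
    (Smat k * coinC θ (-ζ) * Smat k * coinC θ ζ).charpoly =
      X ^ 2 -
        C ((2 * (Real.cos θ ^ 2 * Real.cos (2 * k) + Real.sin θ ^ 2 * Real.cos (2 * ζ)) : ℝ) : ℂ) * X
        + C 1 := by
  have hexp : ∀ x : ℝ, Complex.exp (Complex.I * x) * Complex.exp (-Complex.I * x) = 1 := by
    intro x
    rw [← Complex.exp_add, neg_mul, add_neg_cancel, Complex.exp_zero]
  have hcos : ∀ x : ℝ, 2 * (Real.cos (2 * x) : ℂ) =
      Complex.exp (Complex.I * x) ^ 2 + Complex.exp (-Complex.I * x) ^ 2 := by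
    intro x
    rw [Complex.ofReal_cos, Complex.two_cos, ← Complex.exp_nat_mul, ← Complex.exp_nat_mul]
    congr 2 <;> (push_cast; ring)
  have hcs : (Real.cos θ : ℂ) ^ 2 + (Real.sin θ : ℂ) ^ 2 = 1 := by
    exact_mod_cast Real.cos_sq_add_sin_sq θ
  have hS : (Smat k).det = 1 := by
    rw [Smat, Matrix.det_fin_two_of, hexp]; ring
  have hC : ∀ z : ℝ, (coinC θ z).det = -1 := by
    intro z
    rw [coinC, Matrix.det_fin_two_of]
    linear_combination (-(Real.sin θ : ℂ) ^ 2) * hexp z - hcs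
  have hdet : (Smat k * coinC θ (-ζ) * Smat k * coinC θ ζ).det = 1 := by
    rw [Matrix.det_mul, Matrix.det_mul, Matrix.det_mul, hS, hC, hC]; ring
  have htr : (Smat k * coinC θ (-ζ) * Smat k * coinC θ ζ).trace =
      ((2 * (Real.cos θ ^ 2 * Real.cos (2 * k) + Real.sin θ ^ 2 * Real.cos (2 * ζ)) : ℝ) : ℂ) := by
    have e1 : Complex.exp (-Complex.I * ((-ζ : ℝ) : ℂ)) = Complex.exp (Complex.I * ζ) := by
      congr 1; push_cast; ring
    have e2 : Complex.exp (Complex.I * ((-ζ : ℝ) : ℂ)) = Complex.exp (-Complex.I * ζ) := by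
      congr 1; push_cast; ring
    have h1 := hcos k
    have h2 := hcos ζ
    have h3 := hexp k
    rw [Complex.ofReal_mul, Complex.ofReal_add, Complex.ofReal_mul, Complex.ofReal_mul,
      Complex.ofReal_pow, Complex.ofReal_pow, Complex.ofReal_ofNat]
    unfold Smat coinC
    rw [e1, e2]
    generalize Complex.exp (Complex.I * k) = a at *
    generalize Complex.exp (-Complex.I * k) = b at *
    generalize Complex.exp (Complex.I * ζ) = u at *
    generalize Complex.exp (-Complex.I * ζ) = v at *
    generalize (Real.cos θ : ℂ) = c at *
    generalize (Real.sin θ : ℂ) = s at *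
    generalize (Real.cos (2 * k) : ℂ) = p at *
    generalize (Real.cos (2 * ζ) : ℂ) = q at *
    simp only [Matrix.trace_fin_two, Matrix.mul_apply, Fin.sum_univ_two, Matrix.of_apply,
      Matrix.cons_val', Matrix.cons_val_zero, Matrix.cons_val_one, Matrix.cons_val_fin_one]
    linear_combination (-c ^ 2) * h1 - s ^ 2 * h2 + s ^ 2 * (u ^ 2 + v ^ 2) * h3
  refine ⟨hdet, htr, ?_⟩
  rw [Matrix.charpoly_fin_two, htr, hdet]
end

section
/- Fix m ≥ 0, c ∈ [0,1], p ∈ ℝ and α ∈ (0,1). For ε ∈ (0,1) define θ(ε) = arccos(c·ε^α), ζ(ε) = m·ε·cos(π ε^α)/sin(θ(ε)), and the momentum-space walk operator W(ε) = G(c,−ε^α) ⬝ S(ε^{1−α} p) ⬝ C(θ(ε),−ζ(ε)) ⬝ S(ε^{1−α} p) ⬝ C(θ(ε),ζ(ε)) ⬝ G(c,ε^α). Then as ε → 0⁺, (W(ε) − I)/(2ε) converges to −i·(c·p·σx − m·σz), i.e. the walk has the Dirac Hamiltonian symbol H_D(p) = c p σx − m σz as continuous-spacetime limit. -/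
open Matrix Complex Filter

/-- Pauli matrix σx. -/
def sigmaX : Matrix (Fin 2) (Fin 2) ℂ := !![0, 1; 1, 0]

/-- Pauli matrix σz. -/
def sigmaZ : Matrix (Fin 2) (Fin 2) ℂ := !![1, 0; 0, -1]

/-- f⁺ = √(1−c) + √(1+c). -/
noncomputable def fplus (c : ℝ) : ℝ := Real.sqrt (1 - c) + Real.sqrt (1 + c)

/-- f⁻ = √(1−c) − √(1+c). -/
noncomputable def fminus (c : ℝ) : ℝ := Real.sqrt (1 - c) - Real.sqrt (1 + c)

/-- Λ(c) = (1/2)[[−f⁻, f⁺],[f⁺, f⁻]]. -/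
noncomputable def Lam (c : ℝ) : Matrix (Fin 2) (Fin 2) ℂ :=
  (1 / 2 : ℂ) • !![-(fminus c : ℂ), (fplus c : ℂ); (fplus c : ℂ), (fminus c : ℂ)]

/-- G(c,κ) = ((1+e^{iπκ})/2)·I + ((1−e^{iπκ})/2)·Λ(c). -/
noncomputable def Gmat (c κ : ℝ) : Matrix (Fin 2) (Fin 2) ℂ :=
  ((1 + Complex.exp (Complex.I * Real.pi * κ)) / 2) • (1 : Matrix (Fin 2) (Fin 2) ℂ) +
    ((1 - Complex.exp (Complex.I * Real.pi * κ)) / 2) • Lam c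

/-- θ(ε) = arccos(c·ε^α). -/
noncomputable def thetaF (c α ε : ℝ) : ℝ := Real.arccos (c * ε ^ α)

/-- ζ(ε) = m·ε·cos(π ε^α)/sin(θ(ε)). -/
noncomputable def zetaF (m c α ε : ℝ) : ℝ :=
  m * ε * Real.cos (Real.pi * ε ^ α) / Real.sin (thetaF c α ε)

/-- The momentum-space walk operator W(ε) at momentum p, with scalings
Δt = ε, Δx = ε^{1−α}, κ = ε^α. -/
noncomputable def Wop (m c α p ε : ℝ) : Matrix (Fin 2) (Fin 2) ℂ :=
  Gmat c (-(ε ^ α)) * Smat (ε ^ (1 - α) * p) * coinC (thetaF c α ε) (-(zetaF m c α ε)) *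
    Smat (ε ^ (1 - α) * p) * coinC (thetaF c α ε) (zetaF m c α ε) * Gmat c (ε ^ α)


noncomputable def expQ (z : ℂ) : ℂ := dslope Complex.exp 0 z

lemma exp_eq_expQ (z : ℂ) : Complex.exp z = 1 + z * expQ z := by
  have h := sub_smul_dslope Complex.exp 0 z
  simp only [sub_zero, smul_eq_mul, Complex.exp_zero] at h
  unfold expQ
  rw [h]; ring

lemma tendsto_expQ {l : Filter ℝ} {u : ℝ → ℂ} (h : Tendsto u l (nhds 0)) :
    Tendsto (fun ε => expQ (u ε)) l (nhds 1) := by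
  have hc : ContinuousAt (dslope Complex.exp 0) 0 :=
    continuousAt_dslope_same.2 Complex.differentiableAt_exp
  have h1 : dslope Complex.exp 0 0 = 1 := by simp [dslope_same]
  have := hc.tendsto.comp h
  rw [h1] at this
  exact this

lemma Lam_sq (c : ℝ) (hc : c ∈ Set.Icc (0 : ℝ) 1) : Lam c * Lam c = 1 := by
  have h : (fminus c : ℂ) * fminus c + fplus c * fplus c = 4 := by
    have : fminus c * fminus c + fplus c * fplus c = 4 := by
      unfold fminus fplus
      have h1 := Real.mul_self_sqrt (show 0 ≤ 1 - c by linarith [hc.2])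
      have h2 := Real.mul_self_sqrt (show 0 ≤ 1 + c by linarith [hc.1])
      linear_combination 2 * h1 + 2 * h2
    exact_mod_cast this
  unfold Lam
  ext i j
  fin_cases i <;> fin_cases j <;> simp [Matrix.mul_apply, Fin.sum_univ_two]
  · linear_combination h / 4
  · ring
  · ring
  · linear_combination h / 4

lemma Gmat_inv (c x : ℝ) (hc : c ∈ Set.Icc (0 : ℝ) 1) : Gmat c (-x) * Gmat c x = 1 := by
  have hL := Lam_sq c hc
  have he : Complex.exp (Complex.I * Real.pi * ((-x : ℝ) : ℂ)) *
      Complex.exp (Complex.I * Real.pi * (x : ℂ)) = 1 := by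
    rw [← Complex.exp_add]; push_cast; ring_nf; simp
  unfold Gmat
  generalize Complex.exp (Complex.I * Real.pi * ((-x : ℝ) : ℂ)) = a at *
  generalize Complex.exp (Complex.I * Real.pi * (x : ℂ)) = b at *
  simp only [add_mul, mul_add, smul_mul_assoc, mul_smul_comm, mul_one, one_mul, hL, smul_smul]
  ext i j
  simp only [Matrix.add_apply, Matrix.smul_apply, smul_eq_mul]
  linear_combination ((1 : Matrix (Fin 2) (Fin 2) ℂ) i j / 2 - Lam c i j / 2) * he

lemma tendsto_Gmat (c : ℝ) {l : Filter ℝ} {u : ℝ → ℝ} (h : Tendsto u l (nhds 0)) :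
    Tendsto (fun ε => Gmat c (u ε)) l (nhds 1) := by
  have hc : Continuous (fun x : ℝ => Gmat c x) := by
    unfold Gmat; fun_prop
  have h1 : Gmat c 0 = 1 := by simp [Gmat]
  have := (hc.tendsto 0).comp h
  rw [h1] at this
  exact this

noncomputable def coreM (c x p z s k ζ : ℂ) : Matrix (Fin 2) (Fin 2) ℂ :=
  !![c ^ 2 * x * I * p * expQ (2 * I * k) + s ^ 2 * I * z * expQ (2 * I * ζ),
     - c * s * exp (I * ζ) * I * (p - x * z) * expQ (2 * I * (k - ζ));
     - c * s * exp (-I * ζ) * I * (p - x * z) * expQ (-(2 * I * (k - ζ))),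
     -(c ^ 2 * x * I * p * expQ (-(2 * I * k))) - s ^ 2 * I * z * expQ (-(2 * I * ζ))]

lemma core_eq (θ ζ k ε c x p z : ℝ) (hε : ε ≠ 0) (hcos : Real.cos θ = c * x)
    (hk : x * k = ε * p) (hz : ζ = ε * z) :
    (2 * (ε : ℂ))⁻¹ • (Smat k * coinC θ (-ζ) * Smat k * coinC θ ζ - 1) =
      coreM c x p z (Real.sin θ) k ζ := by
  have hε' : (ε : ℂ) ≠ 0 := by exact_mod_cast hε
  have hs : ((Real.sin θ : ℝ) : ℂ) ^ 2 + (c * x) ^ 2 = 1 := by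
    have := Real.sin_sq_add_cos_sq θ
    rw [hcos] at this
    exact_mod_cast this
  have hk' : (x : ℂ) * k = ε * p := by exact_mod_cast hk
  have hz' : (ζ : ℂ) = ε * z := by exact_mod_cast hz
  have e1 := exp_eq_expQ (2 * I * k)
  have e2 := exp_eq_expQ (2 * I * ζ)
  have e3 := exp_eq_expQ (2 * I * (k - ζ))
  have e4 := exp_eq_expQ (-(2 * I * (k - ζ)))
  have e5 := exp_eq_expQ (-(2 * I * k))
  have e6 := exp_eq_expQ (-(2 * I * ζ))
  have a1 : exp (2 * I * (k : ℂ)) = exp (I * k) * exp (I * k) := by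
    rw [← Complex.exp_add]; ring_nf
  have a2 : exp (2 * I * (ζ : ℂ)) = exp (I * ζ) * exp (I * ζ) := by
    rw [← Complex.exp_add]; ring_nf
  have a3 : exp (2 * I * ((k : ℂ) - ζ)) =
      exp (I * k) * exp (I * k) * (exp (-(I * ζ)) * exp (-(I * ζ))) := by
    simp only [← Complex.exp_add]; ring_nf
  have a4 : exp (-(2 * I * ((k : ℂ) - ζ))) =
      exp (-(I * k)) * exp (-(I * k)) * (exp (I * ζ) * exp (I * ζ)) := by
    simp only [← Complex.exp_add]; ring_nf
  have a5 : exp (-(2 * I * (k : ℂ))) = exp (-(I * k)) * exp (-(I * k)) := by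
    rw [← Complex.exp_add]; ring_nf
  have a6 : exp (-(2 * I * (ζ : ℂ))) = exp (-(I * ζ)) * exp (-(I * ζ)) := by
    rw [← Complex.exp_add]; ring_nf
  have b1 : exp (I * (k : ℂ)) * exp (-(I * k)) = 1 := by
    rw [← Complex.exp_add]; simp
  have b2 : exp (I * (ζ : ℂ)) * exp (-(I * ζ)) = 1 := by
    rw [← Complex.exp_add]; simp
  rw [a1] at e1
  rw [a2] at e2
  rw [a3] at e3
  rw [a4] at e4
  rw [a5] at e5
  rw [a6] at e6
  have key : Smat k * coinC θ (-ζ) * Smat k * coinC θ ζ - 1 =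
      (2 * (ε : ℂ)) • coreM c x p z (Real.sin θ) k ζ := by
    unfold Smat coinC coreM
    rw [hcos]
    generalize Real.sin θ = s at *
    generalize expQ (2 * I * k) = E1 at *
    generalize expQ (2 * I * ζ) = E2 at *
    generalize expQ (2 * I * (k - ζ)) = E3 at *
    generalize expQ (-(2 * I * (k - ζ))) = E4 at *
    generalize expQ (-(2 * I * k)) = E5 at *
    generalize expQ (-(2 * I * ζ)) = E6 at *
    simp only [ofReal_neg, neg_mul, mul_neg, neg_neg, ofReal_mul]
    generalize exp (I * (k : ℂ)) = K at *
    generalize exp (-(I * (k : ℂ))) = K' at *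
    generalize exp (I * (ζ : ℂ)) = Z at *
    generalize exp (-(I * (ζ : ℂ))) = Z' at *
    generalize (s : ℂ) = s at *
    ext i j
    fin_cases i <;> fin_cases j <;>
      simp [Matrix.mul_apply, Fin.sum_univ_two]
    · linear_combination c ^ 2 * x ^ 2 * e1 + s ^ 2 * e2 + hs + 2 * c ^ 2 * x * I * E1 * hk' + 2 * s ^ 2 * I * E2 * hz' + s ^ 2 * Z ^ 2 * b1
    · linear_combination -c * x * s * Z * e3 + c * x * s * Z * b1 + c * x * s * K ^ 2 * Z' * b2 - 2 * I * c * s * Z * E3 * (hk' - x * hz')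
    · linear_combination c * x * s * Z' * e4 - c * x * s * Z' * b1 - c * x * s * K' ^ 2 * Z * b2 - 2 * I * c * s * Z' * E4 * (hk' - x * hz')
    · linear_combination c ^ 2 * x ^ 2 * e5 + s ^ 2 * e6 + hs - 2 * c ^ 2 * x * I * E5 * hk' - 2 * s ^ 2 * I * E6 * hz' + s ^ 2 * Z' ^ 2 * b1
  rw [key, smul_smul, inv_mul_cancel₀ (by simpa using hε'), one_smul]

lemma tendsto_core (c p m : ℝ) {l : Filter ℝ} {x z s k ζ : ℝ → ℝ}
    (hx : Tendsto x l (nhds 0)) (hz : Tendsto z l (nhds m)) (hs : Tendsto s l (nhds 1))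
    (hk : Tendsto k l (nhds 0)) (hζ : Tendsto ζ l (nhds 0)) :
    Tendsto (fun ε => coreM c (x ε) p (z ε) (s ε) (k ε) (ζ ε)) l
      (nhds ((-Complex.I) • (((c * p : ℝ) : ℂ) • sigmaX - (m : ℂ) • sigmaZ))) := by
  have cast : ∀ {u : ℝ → ℝ} {a : ℝ}, Tendsto u l (nhds a) →
      Tendsto (fun ε => (u ε : ℂ)) l (nhds (a : ℂ)) := fun h =>
    (Complex.continuous_ofReal.tendsto _).comp h
  have hx' := cast hx
  have hz' := cast hz
  have hs' := cast hs
  have hk' := cast hk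
  have hζ' := cast hζ
  simp only [ofReal_zero, ofReal_one] at hx' hs' hk' hζ'
  have t1 : Tendsto (fun ε => 2 * I * (k ε : ℂ)) l (nhds 0) := by
    simpa using hk'.const_mul (2 * I)
  have t2 : Tendsto (fun ε => 2 * I * (ζ ε : ℂ)) l (nhds 0) := by
    simpa using hζ'.const_mul (2 * I)
  have t3 : Tendsto (fun ε => 2 * I * ((k ε : ℂ) - ζ ε)) l (nhds 0) := by
    simpa using (hk'.sub hζ').const_mul (2 * I)
  have q1 := tendsto_expQ t1
  have q2 := tendsto_expQ t2
  have q3 := tendsto_expQ t3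
  have q4 := tendsto_expQ (by simpa using t3.neg : Tendsto (fun ε => -(2 * I * ((k ε : ℂ) - ζ ε))) l (nhds 0))
  have q5 := tendsto_expQ (by simpa using t1.neg : Tendsto (fun ε => -(2 * I * (k ε : ℂ))) l (nhds 0))
  have q6 := tendsto_expQ (by simpa using t2.neg : Tendsto (fun ε => -(2 * I * (ζ ε : ℂ))) l (nhds 0))
  have x1 : Tendsto (fun ε => exp (I * (ζ ε : ℂ))) l (nhds 1) := by
    simpa using (hζ'.const_mul I).cexp
  have x2 : Tendsto (fun ε => exp (-I * (ζ ε : ℂ))) l (nhds 1) := by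
    simpa using (hζ'.const_mul (-I)).cexp
  have hpx := (hx'.mul hz').const_sub (p : ℂ)
  refine tendsto_pi_nhds.2 fun i => ?_
  refine tendsto_pi_nhds.2 fun j => ?_
  fin_cases i <;> fin_cases j <;> simp [coreM, sigmaX, sigmaZ]
  · have := ((((hx'.const_mul ((c : ℂ) ^ 2)).mul_const I).mul_const (p : ℂ)).mul q1).add
      ((((hs'.pow 2).mul_const I).mul hz').mul q2)
    simpa using this
  · have := (((((hs'.const_mul (c : ℂ)).mul x1).mul_const I).mul hpx).mul q3)
    convert this using 2 <;> (try simp) <;> (try ring_nf)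
  · have := (((((hs'.const_mul (c : ℂ)).mul x2).mul_const I).mul hpx).mul q4)
    convert this using 2 <;> (try simp) <;> (try ring_nf)
  · have := ((((hx'.const_mul ((c : ℂ) ^ 2)).mul_const I).mul_const (p : ℂ)).mul q5).neg.sub
      ((((hs'.pow 2).mul_const I).mul hz').mul q6)
    simpa using this

theorem plasticQW_continuous_spacetime_limit (m c p α : ℝ)
    (hm : 0 ≤ m) (hc : c ∈ Set.Icc (0 : ℝ) 1) (hα : α ∈ Set.Ioo (0 : ℝ) 1) :
    Tendsto (fun ε : ℝ => (2 * (ε : ℂ))⁻¹ • (Wop m c α p ε - 1))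
      (nhdsWithin 0 (Set.Ioi 0))
      (nhds ((-Complex.I) • (((c * p : ℝ) : ℂ) • sigmaX - (m : ℂ) • sigmaZ))) := by
  have hpow : ∀ b : ℝ, 0 < b →
      Tendsto (fun ε : ℝ => ε ^ b) (nhdsWithin 0 (Set.Ioi 0)) (nhds 0) := by
    intro b hb
    have := (Real.continuousAt_rpow_const 0 b (Or.inr hb.le)).tendsto
    rw [Real.zero_rpow hb.ne'] at this
    exact this.mono_left nhdsWithin_le_nhds
  have hx := hpow α hα.1
  have hk : Tendsto (fun ε : ℝ => ε ^ (1 - α) * p) (nhdsWithin 0 (Set.Ioi 0)) (nhds 0) := by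
    simpa using (hpow (1 - α) (by linarith [hα.2])).mul_const p
  have hs : Tendsto (fun ε : ℝ => Real.sin (thetaF c α ε)) (nhdsWithin 0 (Set.Ioi 0))
      (nhds 1) := by
    have hcont : Continuous (fun x : ℝ => Real.sin (Real.arccos (c * x))) := by fun_prop
    have := (hcont.tendsto 0).comp hx
    simp only [mul_zero, Real.arccos_zero, Real.sin_pi_div_two] at this
    exact this
  have hz : Tendsto (fun ε : ℝ => m * Real.cos (Real.pi * ε ^ α) / Real.sin (thetaF c α ε))
      (nhdsWithin 0 (Set.Ioi 0)) (nhds m) := by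
    have hcont : Continuous (fun x : ℝ => m * Real.cos (Real.pi * x)) := by fun_prop
    have := ((hcont.tendsto 0).comp hx).div hs one_ne_zero
    simp only [mul_zero, Real.cos_zero, mul_one, div_one] at this
    exact this
  have hid : Tendsto (fun ε : ℝ => ε) (nhdsWithin 0 (Set.Ioi 0)) (nhds 0) :=
    tendsto_id.mono_left nhdsWithin_le_nhds
  have hζ : Tendsto (fun ε : ℝ => zetaF m c α ε) (nhdsWithin 0 (Set.Ioi 0)) (nhds 0) := by
    have := hid.mul hz
    rw [zero_mul] at this
    refine this.congr fun ε => ?_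
    unfold zetaF; ring
  have hcore := tendsto_core c p m hx hz hs hk hζ
  have hG := tendsto_Gmat c hx
  have hG' := tendsto_Gmat c (by simpa using hx.neg :
    Tendsto (fun ε : ℝ => -(ε ^ α)) (nhdsWithin 0 (Set.Ioi 0)) (nhds 0))
  have hall := (hG'.mul hcore).mul hG
  rw [one_mul, mul_one] at hall
  refine hall.congr' ?_
  have hlt : ∀ᶠ ε : ℝ in nhdsWithin 0 (Set.Ioi 0), ε ^ α < 1 := hx.eventually_lt_const one_pos
  filter_upwards [self_mem_nhdsWithin, hlt] with ε hε hε1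
  have hε : 0 < ε := hε
  have hxp : 0 ≤ ε ^ α := Real.rpow_nonneg hε.le _
  rw [← core_eq (thetaF c α ε) (zetaF m c α ε) (ε ^ (1 - α) * p) ε c (ε ^ α) p
    (m * Real.cos (Real.pi * ε ^ α) / Real.sin (thetaF c α ε)) hε.ne' ?_ ?_ ?_]
  · rw [mul_smul_comm, smul_mul_assoc, mul_sub, sub_mul, mul_one, Gmat_inv c _ hc]
    simp only [Wop, mul_assoc]
  · unfold thetaF
    rw [Real.cos_arccos]
    · nlinarith [hc.1, mul_nonneg hc.1 hxp]
    · nlinarith [hc.1, hc.2]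
  · rw [← mul_assoc, ← Real.rpow_add hε]; simp
  · unfold zetaF; ring
end

section
/- Let c : ℝ → ℝ and ψ : ℝ → ℂ² both be differentiable at a point x, and let m ∈ ℝ. Then as δ → 0 (δ ≠ 0), the curved lattice-fermion difference operator (i/(2δ))·σx·(c(x − δ/2)·ψ(x − δ) − c(x + δ/2)·ψ(x + δ)) − m·σz·ψ(x) converges to −i·c(x)·σx·ψ'(x) − (i/2)·c'(x)·σx·ψ(x) − m·σz·ψ(x), the curved-spacetime Dirac Hamiltonian in synchronous coordinates applied to ψ at x. -/
open Matrix Complex Filter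

lemma aux_scalar (c : ℝ → ℝ) (f : ℝ → ℂ) (x : ℝ) (c' : ℝ) (f' : ℂ)
    (hc : HasDerivAt c c' x) (hf : HasDerivAt f f' x) :
    Tendsto (fun δ : ℝ => (Complex.I / (2 * δ)) *
      ((c (x - δ / 2) : ℂ) * f (x - δ) - (c (x + δ / 2) : ℂ) * f (x + δ)))
      (nhdsWithin 0 {0}ᶜ)
      (nhds ((-Complex.I * (c x : ℂ)) * f' - (Complex.I / 2 * (c' : ℂ)) * f x)) := by
  have a1 : HasDerivAt (fun δ : ℝ => x - δ / 2) (-(1 / 2)) 0 :=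
    ((hasDerivAt_id (0 : ℝ)).div_const 2).const_sub x
  have a2 : HasDerivAt (fun δ : ℝ => x + δ / 2) (1 / 2) 0 :=
    ((hasDerivAt_id (0 : ℝ)).div_const 2).const_add x
  have a3 : HasDerivAt (fun δ : ℝ => x - δ) (-1) 0 := (hasDerivAt_id (0 : ℝ)).const_sub x
  have a4 : HasDerivAt (fun δ : ℝ => x + δ) 1 0 := (hasDerivAt_id (0 : ℝ)).const_add x
  have b1 : HasDerivAt (fun δ : ℝ => ((c (x - δ / 2) : ℝ) : ℂ)) ((c' * (-(1 / 2)) : ℝ) : ℂ) 0 :=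
    (HasDerivAt.comp (0 : ℝ) (by simpa using hc) a1).ofReal_comp
  have b2 : HasDerivAt (fun δ : ℝ => ((c (x + δ / 2) : ℝ) : ℂ)) ((c' * (1 / 2) : ℝ) : ℂ) 0 :=
    (HasDerivAt.comp (0 : ℝ) (by simpa using hc) a2).ofReal_comp
  have b3 : HasDerivAt (fun δ : ℝ => f (x - δ)) ((-1 : ℝ) • f') 0 :=
    HasDerivAt.scomp (0 : ℝ) (by simpa using hf) a3
  have b4 : HasDerivAt (fun δ : ℝ => f (x + δ)) ((1 : ℝ) • f') 0 :=
    HasDerivAt.scomp (0 : ℝ) (by simpa using hf) a4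
  have key := ((b1.mul b3).sub (b2.mul b4)).tendsto_slope_zero.const_mul (Complex.I / 2)
  refine (key.congr' ?_).trans (le_of_eq ?_)
  · filter_upwards [self_mem_nhdsWithin] with δ hδ
    have hδ' : (δ : ℂ) ≠ 0 := by simpa using hδ
    simp
    field_simp
  · congr 1
    simp
    ring

theorem curved_lattice_fermion_continuum_limit
    (c : ℝ → ℝ) (ψ : ℝ → Fin 2 → ℂ) (x m : ℝ)
    (hc : DifferentiableAt ℝ c x) (hψ : DifferentiableAt ℝ ψ x) :
    Tendsto (fun δ : ℝ =>
        (Complex.I / (2 * δ)) •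
            sigmaX.mulVec (((c (x - δ / 2) : ℂ) • ψ (x - δ)) - ((c (x + δ / 2) : ℂ) • ψ (x + δ)))
          - (m : ℂ) • sigmaZ.mulVec (ψ x))
      (nhdsWithin 0 {0}ᶜ)
      (nhds ((-Complex.I * (c x : ℂ)) • sigmaX.mulVec (deriv ψ x)
        - (Complex.I / 2 * ((deriv c x : ℝ) : ℂ)) • sigmaX.mulVec (ψ x)
        - (m : ℂ) • sigmaZ.mulVec (ψ x))) := by
  refine Tendsto.sub_const ?_ _
  have hd := hasDerivAt_pi.1 hψ.hasDerivAt
  rw [tendsto_pi_nhds]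
  intro i
  fin_cases i
  · simpa [sigmaX, Matrix.mulVec, dotProduct, Fin.sum_univ_two] using
      aux_scalar c (fun y => ψ y 1) x _ _ hc.hasDerivAt (hd 1)
  · simpa [sigmaX, Matrix.mulVec, dotProduct, Fin.sum_univ_two] using
      aux_scalar c (fun y => ψ y 0) x _ _ hc.hasDerivAt (hd 0)
end

section
/- Let c : ℝ → ℝ be continuously differentiable, m ∈ ℝ, and let Ψ : ℝ × ℝ → ℂ² be continuously differentiable and satisfy: (a) there exists R > 0 such that Ψ(t,x) = 0 whenever |x| ≥ R, and (b) the curved-spacetime Dirac equation in synchronous coordinates ∂ₜΨ(t,x) = −c(x)·σx·∂ₓΨ(t,x) − (1/2)·c'(x)·σx·Ψ(t,x) + i·m·σz·Ψ(t,x) for all t,x. Then the L² norm is conserved: the function t ↦ ∫_ℝ ‖Ψ(t,x)‖² dx is constant. -/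
open Matrix Complex MeasureTheory

theorem curved_dirac_L2_norm_conservation
    (c : ℝ → ℝ) (m : ℝ) (Ψ : ℝ × ℝ → Fin 2 → ℂ)
    (hc : ContDiff ℝ 1 c) (hΨ : ContDiff ℝ 1 Ψ)
    (hsupp : ∃ R > 0, ∀ t x : ℝ, R ≤ |x| → Ψ (t, x) = 0)
    (hPDE : ∀ t x : ℝ,
      deriv (fun s => Ψ (s, x)) t =
        (-(c x : ℂ)) • sigmaX.mulVec (deriv (fun y => Ψ (t, y)) x)
          - (((deriv c x / 2 : ℝ)) : ℂ) • sigmaX.mulVec (Ψ (t, x))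
          + (Complex.I * m) • sigmaZ.mulVec (Ψ (t, x))) :
    ∀ t₁ t₂ : ℝ,
      (∫ x : ℝ, ∑ i, ‖Ψ (t₁, x) i‖ ^ 2) = ∫ x : ℝ, ∑ i, ‖Ψ (t₂, x) i‖ ^ 2 := by
  obtain ⟨R, hR, hsupp⟩ := hsupp
  set f : ℝ × ℝ → ℝ := fun z =>
    (Ψ z 0).re ^ 2 + (Ψ z 0).im ^ 2 + ((Ψ z 1).re ^ 2 + (Ψ z 1).im ^ 2) with hf
  set g : ℝ × ℝ → ℝ := fun z =>
    2 * c z.2 * ((Ψ z 0).re * (Ψ z 1).re + (Ψ z 0).im * (Ψ z 1).im) with hg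
  have hcomp : ∀ i, ContDiff ℝ 1 (fun z => Ψ z i) := fun i => contDiff_pi.1 hΨ i
  have hre : ∀ i, ContDiff ℝ 1 (fun z => (Ψ z i).re) := fun i =>
    Complex.reCLM.contDiff.comp (hcomp i)
  have him : ∀ i, ContDiff ℝ 1 (fun z => (Ψ z i).im) := fun i =>
    Complex.imCLM.contDiff.comp (hcomp i)
  have hc2 : ContDiff ℝ 1 (fun z : ℝ × ℝ => c z.2) := hc.comp contDiff_snd
  have hfC : ContDiff ℝ 1 f :=
    (((hre 0).pow 2).add ((him 0).pow 2)).add (((hre 1).pow 2).add ((him 1).pow 2))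
  have hgC : ContDiff ℝ 1 g :=
    (contDiff_const.mul hc2).mul (((hre 0).mul (hre 1)).add ((him 0).mul (him 1)))
  have hdiv : ∀ t x : ℝ, fderiv ℝ f (t, x) (1, 0) + fderiv ℝ g (t, x) (0, 1) = 0 := by
    intro t x
    have e1 : HasDerivAt (fun s : ℝ => (s, x)) ((1 : ℝ), (0 : ℝ)) t :=
      (hasDerivAt_id t).prodMk (hasDerivAt_const t x)
    have e2 : HasDerivAt (fun y : ℝ => (t, y)) ((0 : ℝ), (1 : ℝ)) x :=
      (hasDerivAt_const x t).prodMk (hasDerivAt_id x)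
    have F1 : HasDerivAt (fun s => f (s, x)) (fderiv ℝ f (t, x) (1, 0)) t := by
      have h0 : HasFDerivAt f (fderiv ℝ f (t, x)) (t, x) :=
        ((hfC.differentiable one_ne_zero) (t, x)).hasFDerivAt
      have h1 := HasFDerivAt.comp_hasDerivAt (l := f) t h0 e1
      exact h1
    have G1 : HasDerivAt (fun y => g (t, y)) (fderiv ℝ g (t, x) (0, 1)) x := by
      have h0 : HasFDerivAt g (fderiv ℝ g (t, x)) (t, x) :=
        ((hgC.differentiable one_ne_zero) (t, x)).hasFDerivAt
      have h1 := HasFDerivAt.comp_hasDerivAt (l := g) x h0 e2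
      exact h1
    have P1 : HasDerivAt (fun s => Ψ (s, x)) (deriv (fun s => Ψ (s, x)) t) t :=
      (((hΨ.differentiable one_ne_zero) (t, x)).hasFDerivAt.comp_hasDerivAt t
        e1).differentiableAt.hasDerivAt
    have P2 : HasDerivAt (fun y => Ψ (t, y)) (deriv (fun y => Ψ (t, y)) x) x :=
      (((hΨ.differentiable one_ne_zero) (t, x)).hasFDerivAt.comp_hasDerivAt x
        e2).differentiableAt.hasDerivAt
    have C1 : HasDerivAt c (deriv c x) x := (hc.differentiable one_ne_zero x).hasDerivAt
    rw [hPDE t x] at P1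
    generalize deriv (fun y => Ψ (t, y)) x = D at P1 P2
    generalize deriv c x = c' at P1 C1
    have R1 := fun i => Complex.reCLM.hasFDerivAt.comp_hasDerivAt t (hasDerivAt_pi.1 P1 i)
    have I1 := fun i => Complex.imCLM.hasFDerivAt.comp_hasDerivAt t (hasDerivAt_pi.1 P1 i)
    have R2 := fun i => Complex.reCLM.hasFDerivAt.comp_hasDerivAt x (hasDerivAt_pi.1 P2 i)
    have I2 := fun i => Complex.imCLM.hasFDerivAt.comp_hasDerivAt x (hasDerivAt_pi.1 P2 i)
    have F2 := ((((R1 0).pow 2).add ((I1 0).pow 2)).add (((R1 1).pow 2).add ((I1 1).pow 2)))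
    have G2 := ((C1.const_mul 2).mul (((R2 0).mul (R2 1)).add ((I2 0).mul (I2 1))))
    rw [F1.unique F2, G1.unique G2]
    simp [sigmaX, sigmaZ, Matrix.mulVec, dotProduct, Fin.sum_univ_two]
    ring
  have hzero : ∀ t x : ℝ, R ≤ |x| → f (t, x) = 0 := by
    intro t x hx
    simp [hf, hsupp t x hx]
  have hgzero : ∀ t x : ℝ, R ≤ |x| → g (t, x) = 0 := by
    intro t x hx
    simp [hg, hsupp t x hx]
  have hint : ∀ t : ℝ, (∫ x : ℝ, ∑ i, ‖Ψ (t, x) i‖ ^ 2) = ∫ x in (-R)..R, f (t, x) := by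
    intro t
    rw [intervalIntegral.integral_eq_integral_of_support_subset]
    · congr 1
      ext x
      simp only [Fin.sum_univ_two, hf, ← Complex.normSq_eq_norm_sq, Complex.normSq_apply]
      ring
    · intro x hx
      have : ¬ R ≤ |x| := fun h => hx (hzero t x h)
      have h2 := abs_lt.1 (not_le.1 this)
      exact ⟨h2.1, h2.2.le⟩
  intro t₁ t₂
  rw [hint, hint]
  have key := integral2_divergence_prod_of_hasFDerivAt f g (fderiv ℝ f) (fderiv ℝ g)
    t₁ (-R) t₂ R hfC.continuous.continuousOn hgC.continuous.continuousOn
    (fun z _ => ((hfC.differentiable one_ne_zero) z).hasFDerivAt)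
    (fun z _ => ((hgC.differentiable one_ne_zero) z).hasFDerivAt)
    (by
      have : (fun z => fderiv ℝ f z (1, 0) + fderiv ℝ g z (0, 1)) = fun _ => (0 : ℝ) :=
        funext fun z => hdiv z.1 z.2
      rw [this]
      exact integrableOn_zero)
  simp only [hdiv, hgzero _ R (le_abs_self R), hgzero _ (-R) (by rw [abs_neg]; exact le_abs_self R),
    intervalIntegral.integral_zero] at key
  linarith
end
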